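/- Let A ∈ ℝ^{n×n}, B ∈ ℝ^{n×m}, and let K ∈ ℝ^{m×n} be such that A + BK is Hurwitz (every eigenvalue of A + BK has negative real part). Then there exist τ > 0, a symmetric positive definite P ∈ S^n_+, and diagonal positive definite S₁, S₂ ∈ D^n_+ such that the symmetric 2n×2n block matrix [[ (A+BK)ᵀP + P(A+BK) + τP , P B K − S₂ ], [ (P B K − S₂)ᵀ , −S₁ − 2S₂ ]] is negative definite and Δᵀ S₁ Δ − τ ≤ 0. -/

import Mathlib

open Matrix

noncomputable section

/-- A real square matrix is Hurwitz if all its complex eigenvalues have negative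
real part. -/
def Matrix.IsHurwitz {n : ℕ} (M : Matrix (Fin n) (Fin n) ℝ) : Prop :=
  ∀ μ ∈ spectrum ℂ (M.map (algebraMap ℝ ℂ)), μ.re < 0

section Helpers

theorem perturb_posDef {n : ℕ} (Q R : Matrix (Fin n) (Fin n) ℝ) (hQ : Q.PosDef)
    (hR : R.IsHermitian) :
    ∃ e : ℝ, 0 < e ∧ (Q - e • R).PosDef := by
  have hc : ∀ M : Matrix (Fin n) (Fin n) ℝ, Continuous (fun x : Fin n → ℝ => x ⬝ᵥ (M *ᵥ x)) := by
    intro M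
    exact continuous_id.dotProduct (continuous_const.matrix_mulVec continuous_id)
  have hQp : ∀ x : Fin n → ℝ, x ≠ 0 → 0 < x ⬝ᵥ (Q *ᵥ x) := by
    intro x hx
    simpa using hQ.dotProduct_mulVec_pos hx
  have hK : IsCompact (Metric.sphere (0 : Fin n → ℝ) 1) := isCompact_sphere _ _
  have hne : ∀ x ∈ Metric.sphere (0 : Fin n → ℝ) 1, x ≠ 0 := by
    intro x hx h0
    simp [h0] at hx
  obtain ⟨C, hC⟩ := hK.bddAbove_image (f := fun x => (x ⬝ᵥ (R *ᵥ x)) / (x ⬝ᵥ (Q *ᵥ x)))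
    ((hc R).continuousOn.div (hc Q).continuousOn (fun x hx => (hQp x (hne x hx)).ne'))
  have key : ∀ x : Fin n → ℝ, x ≠ 0 → x ⬝ᵥ (R *ᵥ x) ≤ C * (x ⬝ᵥ (Q *ᵥ x)) := by
    intro x hx
    have hn : 0 < ‖x‖ := norm_pos_iff.mpr hx
    have hm : ‖x‖⁻¹ • x ∈ Metric.sphere (0 : Fin n → ℝ) 1 := by
      simp [norm_smul, hn.ne']
    have h1 := hC (Set.mem_image_of_mem _ hm)
    simp only [mulVec_smul, dotProduct_smul, smul_dotProduct, smul_eq_mul] at h1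
    have hi : ‖x‖⁻¹ ≠ 0 := inv_ne_zero hn.ne'
    rw [mul_div_mul_left _ _ hi, mul_div_mul_left _ _ hi, div_le_iff₀ (hQp x hx)] at h1
    exact h1
  have hpos : 0 < |C| + 1 := by positivity
  refine ⟨(|C| + 1)⁻¹, inv_pos.mpr hpos, ?_⟩
  refine PosDef.of_dotProduct_mulVec_pos ?_ ?_
  · refine hQ.isHermitian.sub ?_
    rw [IsHermitian, conjTranspose_smul, hR.eq]; simp
  · intro x hx
    have h1 := key x hx
    have h2 := hQp x hx
    have h3 : x ⬝ᵥ (R *ᵥ x) < (|C| + 1) * (x ⬝ᵥ (Q *ᵥ x)) := by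
      nlinarith [le_abs_self C]
    simp only [star_trivial, sub_mulVec, smul_mulVec, dotProduct_sub, dotProduct_smul, smul_eq_mul]
    rw [sub_pos, inv_mul_lt_iff₀ hpos]
    exact h3

open scoped Matrix.Norms.L2Operator in
theorem exists_pow_norm_lt {n : ℕ} (C : Matrix (Fin n) (Fin n) ℂ)
    (h : ∀ z ∈ spectrum ℂ C, ‖z‖ < 1) : ∃ N : ℕ, ‖C ^ N‖ < 1 := by
  rcases subsingleton_or_nontrivial (Matrix (Fin n) (Fin n) ℂ) with hs | hs
  · exact ⟨0, by rw [Subsingleton.elim (C ^ 0) 0]; simp⟩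
  · have h1 : spectralRadius ℂ C < ((1 : NNReal) : ENNReal) :=
      spectrum.spectralRadius_lt_of_forall_lt C (fun z hz => h z hz)
    have h2 := spectrum.pow_norm_pow_one_div_tendsto_nhds_spectralRadius C
    have h3 := (h2.eventually_lt_const h1).and (Filter.eventually_gt_atTop 0)
    obtain ⟨N, hN, hN0⟩ := h3.exists
    refine ⟨N, ?_⟩
    by_contra hcon
    push Not at hcon
    have : (1 : ℝ) ≤ ‖C ^ N‖ ^ (1 / N : ℝ) := Real.one_le_rpow hcon (by positivity)
    rw [ENNReal.coe_one, ENNReal.ofReal_lt_one] at hN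
    linarith

open scoped Matrix.Norms.L2Operator in
theorem exists_pow_contract {n : ℕ} (C : Matrix (Fin n) (Fin n) ℝ)
    (h : ∀ z ∈ spectrum ℂ (C.map (algebraMap ℝ ℂ)), ‖z‖ < 1) :
    ∃ N : ℕ, ∀ x : Fin n → ℝ, x ≠ 0 → (C ^ N *ᵥ x) ⬝ᵥ (C ^ N *ᵥ x) < x ⬝ᵥ x := by
  obtain ⟨N, hN⟩ := exists_pow_norm_lt _ h
  refine ⟨N, fun x hx => ?_⟩
  have hp : (C.map (algebraMap ℝ ℂ)) ^ N = (C ^ N).map (algebraMap ℝ ℂ) :=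
    (map_pow (algebraMap ℝ ℂ).mapMatrix C N).symm
  rw [hp] at hN
  set D := C ^ N
  have hnorm : ∀ y : Fin n → ℝ,
      ‖WithLp.toLp 2 (fun i => (y i : ℂ))‖ ^ 2 = y ⬝ᵥ y := by
    intro y
    rw [EuclideanSpace.norm_sq_eq]
    simp [dotProduct, sq]
  have h1 := l2_opNorm_mulVec (D.map (algebraMap ℝ ℂ)) (WithLp.toLp 2 (fun i => (x i : ℂ)))
  have h2 : (D.map (algebraMap ℝ ℂ)) *ᵥ (fun i => (x i : ℂ)) = fun i => ((D *ᵥ x) i : ℂ) := by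
    ext i
    simp [mulVec, dotProduct]
  have hxx : 0 < x ⬝ᵥ x := by simpa using dotProduct_star_self_pos_iff.mpr hx
  simp only [h2] at h1
  have e1 := hnorm x
  have e2 := hnorm (D *ᵥ x)
  change ‖WithLp.toLp 2 (fun i => ((D *ᵥ x) i : ℂ))‖ ≤ _ at h1
  rw [← e1, ← e2]
  rw [← e1] at hxx
  have hx0 : 0 < ‖WithLp.toLp 2 (fun i => (x i : ℂ))‖ := by
    by_contra hc
    have : ‖WithLp.toLp 2 (fun i => (x i : ℂ))‖ = 0 := le_antisymm (not_lt.mp hc) (norm_nonneg _)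
    simp [this] at hxx
  refine pow_lt_pow_left₀ (lt_of_le_of_lt h1 ?_) (norm_nonneg _) two_ne_zero
  exact mul_lt_of_lt_one_left hx0 hN

theorem dot_self_eq {n : ℕ} (D : Matrix (Fin n) (Fin n) ℝ) (x : Fin n → ℝ) :
    x ⬝ᵥ ((Dᵀ * D) *ᵥ x) = (D *ᵥ x) ⬝ᵥ (D *ᵥ x) := by
  rw [← mulVec_mulVec, dotProduct_mulVec, vecMul_transpose]

/-- Discrete Lyapunov (Stein) inequality. -/
theorem stein {n : ℕ} (C : Matrix (Fin n) (Fin n) ℝ)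
    (h : ∀ z ∈ spectrum ℂ (C.map (algebraMap ℝ ℂ)), ‖z‖ < 1) :
    ∃ P : Matrix (Fin n) (Fin n) ℝ, P.PosDef ∧ (P - Cᵀ * P * C).PosDef := by
  obtain ⟨N, hN⟩ := exists_pow_contract C h
  have hps : ∀ N : ℕ, (∑ k ∈ Finset.range N, (C ^ k)ᵀ * C ^ k).PosSemidef := by
    intro N
    refine posSemidef_sum _ (fun k _ => ?_)
    simpa using posSemidef_conjTranspose_mul_self (C ^ k)
  have htel : ∀ N : ℕ, (∑ k ∈ Finset.range N, (C ^ k)ᵀ * C ^ k)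
      - Cᵀ * (∑ k ∈ Finset.range N, (C ^ k)ᵀ * C ^ k) * C = 1 - (C ^ N)ᵀ * C ^ N := by
    intro N
    induction N with
    | zero => simp
    | succ k ih =>
      rw [Finset.sum_range_succ, mul_add, add_mul, pow_succ, transpose_mul]
      have : ∀ a b c d : Matrix (Fin n) (Fin n) ℝ, a + b - (c + d) = (a - c) + (b - d) := by
        intros; abel
      rw [this, ih]
      simp only [mul_assoc]
      abel
  have hpd : (1 - (C ^ N)ᵀ * C ^ N).PosDef := by
    refine PosDef.of_dotProduct_mulVec_pos ?_ ?_
    · refine isHermitian_one.sub ?_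
      simpa using isHermitian_conjTranspose_mul_self (C ^ N)
    · intro x hx
      have := hN x hx
      simp only [star_trivial, sub_mulVec, dotProduct_sub, one_mulVec, dot_self_eq]
      linarith
  rcases Nat.eq_zero_or_pos N with h0 | h0
  · -- degenerate: then there is no nonzero vector
    subst h0
    have hz : ∀ x : Fin n → ℝ, x = 0 := by
      intro x
      by_contra hx
      have := hN x hx
      simp at this
    refine ⟨1, PosDef.one, ?_⟩
    refine PosDef.of_dotProduct_mulVec_pos ?_ (fun x hx => absurd (hz x) hx)
    refine isHermitian_one.sub ?_
    simpa using isHermitian_conjTranspose_mul_self C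
  · refine ⟨∑ k ∈ Finset.range N, (C ^ k)ᵀ * C ^ k, ?_, ?_⟩
    · obtain ⟨M, rfl⟩ : ∃ M, N = M + 1 := ⟨N - 1, by omega⟩
      rw [Finset.sum_range_succ']
      have h1 : ((C ^ 0)ᵀ * C ^ 0 : Matrix (Fin n) (Fin n) ℝ) = 1 := by simp
      rw [h1]
      refine PosDef.posSemidef_add (posSemidef_sum _ (fun k _ => ?_)) PosDef.one
      simpa using posSemidef_conjTranspose_mul_self (C ^ (k + 1))
    · rw [htel]; exact hpd

theorem lyapunov {n : ℕ} (M : Matrix (Fin n) (Fin n) ℝ) (hM : M.IsHurwitz) :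
    ∃ P : Matrix (Fin n) (Fin n) ℝ, P.PosDef ∧ (-(Mᵀ * P + P * M)).PosDef := by
  have h1 : IsUnit (1 - M) := by
    have hn : (1 : ℂ) ∉ spectrum ℂ (M.map (algebraMap ℝ ℂ)) := by
      intro hc
      have := hM 1 hc
      norm_num at this
    rw [spectrum.notMem_iff, map_one, isUnit_iff_isUnit_det] at hn
    have he : (1 : Matrix (Fin n) (Fin n) ℂ) - M.map (algebraMap ℝ ℂ)
        = (algebraMap ℝ ℂ).mapMatrix (1 - M) := by
      rw [map_sub, map_one]; rfl
    rw [he, ← RingHom.map_det, isUnit_iff_ne_zero] at hn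
    rw [isUnit_iff_isUnit_det, isUnit_iff_ne_zero]
    intro h0
    rw [h0, map_zero] at hn
    exact hn rfl
  obtain ⟨u, hu⟩ := h1
  set N : Matrix (Fin n) (Fin n) ℝ := ↑u⁻¹
  have hN1 : (1 - M) * N = 1 := by rw [← hu]; exact u.mul_inv
  have hN2 : N * (1 - M) = 1 := by rw [← hu]; exact u.inv_mul
  let φ := (algebraMap ℝ ℂ).mapMatrix (m := Fin n)
  have hφ1 : (1 - φ M) * φ N = 1 := by
    rw [← map_one φ, ← map_sub, ← map_mul, hN1]
  have hφ2 : φ N * (1 - φ M) = 1 := by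
    rw [← map_one φ, ← map_sub, ← map_mul, hN2]
  have hφu : IsUnit (φ N) := ⟨⟨φ N, 1 - φ M, hφ2, hφ1⟩, rfl⟩
  obtain ⟨P, hP, hS⟩ := stein ((1 + M) * N) (by
    intro z hz
    by_contra hcon
    push Not at hcon
    have hCe : ((1 + M) * N).map (algebraMap ℝ ℂ) = (1 + φ M) * φ N := by
      change φ _ = _
      rw [map_mul, map_add, map_one]
    rw [hCe, spectrum.mem_iff] at hz
    apply hz
    have hfac : algebraMap ℂ (Matrix (Fin n) (Fin n) ℂ) z - (1 + φ M) * φ N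
        = ((z - 1) • 1 - (z + 1) • φ M) * φ N := by
      have : algebraMap ℂ (Matrix (Fin n) (Fin n) ℂ) z = (z • (1 - φ M)) * φ N := by
        rw [smul_mul_assoc, hφ1, Algebra.algebraMap_eq_smul_one]
      rw [this, ← sub_mul]
      congr 1
      module
    rw [hfac]
    refine IsUnit.mul ?_ hφu
    by_cases hz1 : z + 1 = 0
    · have : z = -1 := by linear_combination hz1
      subst this
      have : ((-1 - 1 : ℂ) • (1 : Matrix (Fin n) (Fin n) ℂ) - (-1 + 1 : ℂ) • φ M)
        = algebraMap ℂ _ (-2) := by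
        rw [Algebra.algebraMap_eq_smul_one]; norm_num
      rw [this]
      exact (isUnit_iff_ne_zero.mpr (by norm_num)).map _
    · have hμ : (z - 1) / (z + 1) ∉ spectrum ℂ (M.map (algebraMap ℝ ℂ)) := by
        intro hc
        have h2 := hM _ hc
        have h3 : ((z - 1) / (z + 1)).re = (‖z‖ ^ 2 - 1) / Complex.normSq (z + 1) := by
          rw [Complex.div_re, ← Complex.normSq_eq_norm_sq, Complex.normSq_apply z, ← add_div]
          simp
          ring
        rw [h3] at h2
        have h4 : 0 ≤ (‖z‖ ^ 2 - 1) / Complex.normSq (z + 1) :=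
          div_nonneg (by nlinarith) (Complex.normSq_nonneg _)
        linarith
      rw [spectrum.notMem_iff] at hμ
      have : ((z - 1) • (1 : Matrix (Fin n) (Fin n) ℂ) - (z + 1) • φ M)
        = algebraMap ℂ _ (z + 1) * (algebraMap ℂ _ ((z - 1) / (z + 1))
            - M.map (algebraMap ℝ ℂ)) := by
        rw [Algebra.algebraMap_eq_smul_one, Algebra.algebraMap_eq_smul_one, smul_mul_assoc,
          one_mul, smul_sub, smul_smul, mul_div_cancel₀ _ hz1]
        rfl
      rw [this]
      exact ((isUnit_iff_ne_zero.mpr hz1).map _).mul hμ)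
  refine ⟨P, hP, ?_⟩
  have hinj : Function.Injective (1 - M).mulVec := by
    rw [mulVec_injective_iff_isUnit]; exact ⟨u, hu⟩
  have h5 := hS.conjTranspose_mul_mul_same hinj
  rw [conjTranspose_eq_transpose_of_trivial] at h5
  have h6 : (1 - M)ᵀ * (P - ((1 + M) * N)ᵀ * P * ((1 + M) * N)) * (1 - M)
      = (2 : ℝ) • (-(Mᵀ * P + P * M)) := by
    have e1 : (1 - M)ᵀ * (P - ((1 + M) * N)ᵀ * P * ((1 + M) * N)) * (1 - M)
      = (1 - M)ᵀ * P * (1 - M) - (N * (1 - M))ᵀ * (1 + M)ᵀ * P * (1 + M) * (N * (1 - M)) := by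
      simp only [transpose_mul]
      noncomm_ring
    rw [e1, hN2]
    simp only [transpose_one, transpose_sub, transpose_add, two_smul]
    noncomm_ring
  rw [h6] at h5
  have h7 := h5.smul (show (0 : ℝ) < 1 / 2 by norm_num)
  rw [smul_smul] at h7
  norm_num at h7
  simpa using h7

end Helpers

/-- Feasibility of the stability-analysis matrix inequalities: if
`A + BK` is Hurwitz, then there exist `τ > 0`, a symmetric positive definite `P`, and
diagonal positive definite `S₁, S₂` such that the block matrix
`[[(A+BK)ᵀP + P(A+BK) + τP, PBK - S₂], [(PBK - S₂)ᵀ, -S₁ - 2S₂]]` is negative definite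
and `Δᵀ S₁ Δ - τ ≤ 0`. -/
theorem lmi_feasible_of_hurwitz {n m : ℕ} (Δ : Fin n → ℝ) (hΔ : ∀ i, 0 < Δ i)
    (A : Matrix (Fin n) (Fin n) ℝ) (B : Matrix (Fin n) (Fin m) ℝ)
    (K : Matrix (Fin m) (Fin n) ℝ) (hHur : (A + B * K).IsHurwitz) :
    ∃ (τ : ℝ) (P S₁ S₂ : Matrix (Fin n) (Fin n) ℝ),
      0 < τ ∧ P.PosDef ∧ S₁.IsDiag ∧ S₁.PosDef ∧ S₂.IsDiag ∧ S₂.PosDef ∧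
      (-(Matrix.fromBlocks
          ((A + B * K)ᵀ * P + P * (A + B * K) + τ • P) (P * B * K - S₂)
          (P * B * K - S₂)ᵀ (-S₁ - 2 • S₂))).PosDef ∧
      Δ ⬝ᵥ S₁.mulVec Δ - τ ≤ 0 := by
  obtain ⟨P, hP, hQ⟩ := lyapunov _ hHur
  set M := A + B * K with hMdef
  obtain ⟨τ, hτ, hW⟩ := perturb_posDef _ P hQ hP.isHermitian
  set W := -(Mᵀ * P + P * M) - τ • P with hWdef
  set R := P * B * K - 1 with hR
  obtain ⟨e, he, hV⟩ := perturb_posDef W (R * Rᵀ) hW (by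
    simpa using isHermitian_mul_conjTranspose_self R)
  set s : ℝ := τ / (Δ ⬝ᵥ Δ + 1) with hs
  have hΔ0 : 0 ≤ Δ ⬝ᵥ Δ := by simpa using dotProduct_star_self_nonneg Δ
  have hs0 : 0 < s := by positivity
  set ε : ℝ := e * s with hε
  have hε0 : 0 < ε := by positivity
  have hdiag : ∀ c : ℝ, (c • (1 : Matrix (Fin n) (Fin n) ℝ)).IsDiag := fun c =>
    isDiag_one.smul c
  refine ⟨τ, ε • P, s • 1, ε • 1, hτ, hP.smul hε0, hdiag _, PosDef.one.smul hs0, hdiag _,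
    PosDef.one.smul hε0, ?_, ?_⟩
  · have hblk : -(Matrix.fromBlocks
          (Mᵀ * (ε • P) + (ε • P) * M + τ • (ε • P)) ((ε • P) * B * K - ε • 1)
          ((ε • P) * B * K - ε • 1)ᵀ (-(s • 1) - 2 • (ε • (1 : Matrix (Fin n) (Fin n) ℝ))))
        = Matrix.fromBlocks (ε • W) (-(ε • R)) (-(ε • Rᵀ)) ((s + 2 * ε) • 1) := by
      rw [fromBlocks_neg]
      have e1 : (ε • P) * B * K - ε • 1 = ε • R := by
        rw [hR, smul_sub, Matrix.smul_mul, Matrix.smul_mul]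
      rw [e1, transpose_smul]
      congr 1
      · rw [hWdef, mul_smul_comm, smul_mul_assoc]
        module
      · module
    rw [hblk]
    refine PosDef.of_dotProduct_mulVec_pos ?_ ?_
    · refine IsHermitian.fromBlocks ?_ ?_ ?_
      · exact (hW.smul hε0).isHermitian
      · simp
      · exact (PosDef.one.smul (by positivity : 0 < s + 2 * ε)).isHermitian
    · intro v hv
      obtain ⟨x, y, rfl⟩ : ∃ x y, v = Sum.elim x y :=
        ⟨v ∘ Sum.inl, v ∘ Sum.inr, (Sum.elim_comp_inl_inr v).symm⟩
      have hform : star (Sum.elim x y) ⬝ᵥ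
          (Matrix.fromBlocks (ε • W) (-(ε • R)) (-(ε • Rᵀ)) ((s + 2 * ε) • 1) *ᵥ Sum.elim x y)
          = ε * (x ⬝ᵥ (W *ᵥ x)) - 2 * ε * ((Rᵀ *ᵥ x) ⬝ᵥ y) + (s + 2 * ε) * (y ⬝ᵥ y) := by
        have e2 : x ⬝ᵥ (R *ᵥ y) = (Rᵀ *ᵥ x) ⬝ᵥ y := by
          rw [dotProduct_mulVec, mulVec_transpose]
        have e3 : y ⬝ᵥ (Rᵀ *ᵥ x) = (Rᵀ *ᵥ x) ⬝ᵥ y := dotProduct_comm _ _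
        rw [star_trivial, fromBlocks_mulVec, sumElim_dotProduct_sumElim]
        simp only [Sum.elim_comp_inl, Sum.elim_comp_inr, neg_mulVec, smul_mulVec, dotProduct_add,
          dotProduct_neg, dotProduct_smul, one_mulVec, smul_eq_mul, e2, e3]
        ring
      rw [hform]
      set z := Rᵀ *ᵥ x with hz
      have hyy : 0 ≤ y ⬝ᵥ y := by simpa using dotProduct_star_self_nonneg y
      have hsq : 0 ≤ (e • z - y) ⬝ᵥ (e • z - y) := by
        simpa using dotProduct_star_self_nonneg (e • z - y)
      have hsq' : 0 ≤ e ^ 2 * (z ⬝ᵥ z) - 2 * e * (z ⬝ᵥ y) + y ⬝ᵥ y := by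
        have : (e • z - y) ⬝ᵥ (e • z - y)
            = e ^ 2 * (z ⬝ᵥ z) - 2 * e * (z ⬝ᵥ y) + y ⬝ᵥ y := by
          simp only [sub_dotProduct, dotProduct_sub, smul_dotProduct, dotProduct_smul, smul_eq_mul,
            dotProduct_comm y z]
          ring
        rwa [this] at hsq
      have hident : ε * (x ⬝ᵥ (W *ᵥ x)) - 2 * ε * (z ⬝ᵥ y) + (s + 2 * ε) * (y ⬝ᵥ y)
          = ε * (x ⬝ᵥ (W *ᵥ x) - e * (z ⬝ᵥ z))
            + s * (e ^ 2 * (z ⬝ᵥ z) - 2 * e * (z ⬝ᵥ y) + y ⬝ᵥ y) + 2 * ε * (y ⬝ᵥ y) := by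
        rw [hε]; ring
      rw [hident]
      have hzz : x ⬝ᵥ ((W - e • (R * Rᵀ)) *ᵥ x) = x ⬝ᵥ (W *ᵥ x) - e * (z ⬝ᵥ z) := by
        have := dot_self_eq Rᵀ x
        rw [transpose_transpose] at this
        rw [sub_mulVec, smul_mulVec, dotProduct_sub, dotProduct_smul, this, smul_eq_mul]
      have t2 := mul_nonneg hs0.le hsq'
      by_cases hx : x = 0
      · have hy : y ≠ 0 := by
          rintro rfl
          apply hv
          rw [hx]
          ext i; cases i <;> rfl
        have hy' : 0 < y ⬝ᵥ y := by simpa using dotProduct_star_self_pos_iff.mpr hy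
        have hx1 : x ⬝ᵥ (W *ᵥ x) - e * (z ⬝ᵥ z) = 0 := by
          rw [← hzz, hx]; simp
        rw [hx1]
        have : 0 < 2 * ε * (y ⬝ᵥ y) := by positivity
        linarith
      · have hp := hV.dotProduct_mulVec_pos hx
        rw [star_trivial, hzz] at hp
        have t1 := mul_pos hε0 hp
        have t3 : 0 ≤ 2 * ε * (y ⬝ᵥ y) := by positivity
        linarith
  · have h1 : Δ ⬝ᵥ ((s • (1 : Matrix (Fin n) (Fin n) ℝ)) *ᵥ Δ) = s * (Δ ⬝ᵥ Δ) := by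
      rw [smul_mulVec, one_mulVec, dotProduct_smul, smul_eq_mul]
    rw [h1]
    have h2 : s * (Δ ⬝ᵥ Δ + 1) = τ := by rw [hs]; field_simp
    nlinarith

end
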